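/- arXiv:2601.12229 — 5 statements merged into one kernel-verified Lean document; each statement's English description precedes it below -/
import Mathlib

section
/- Let γ₁ < 0, k > 0, 𝔠 > 0 and M₁ > 0. Then there exists exactly one real number Ȳ with M₁·e^{−Ȳ} + k𝔠 + γ₁·Ȳ = 0, and this Ȳ satisfies Ȳ > 0. Moreover, the Hessian of H₁(X,Y) := −M₁·cos X·e^{−Y} − (γ₁/2)·Y² − k𝔠·Y at (π, Ȳ) is diagonal with diagonal entries −M₁·e^{−Ȳ} < 0 and M₁·e^{−Ȳ} − γ₁ > 0; in particular (π, Ȳ) is a nondegenerate saddle point of H₁. -/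
/-- The Hamiltonian of the upper-layer travelling-wave system in the case
`A = 1`: `H₁(X,Y) = −M₁ cos X e^{−Y} − (γ₁/2)Y² − ν Y` with `ν = k𝔠`. -/
noncomputable def H₁ (M₁ ν γ₁ X Y : ℝ) : ℝ :=
  -M₁ * Real.cos X * Real.exp (-Y) - (γ₁ / 2) * Y ^ 2 - ν * Y

theorem not_isLocalMax_of_deriv_deriv_pos {f : ℝ → ℝ} {x : ℝ} (h₂ : 0 < deriv (deriv f) x)
    (h₁ : deriv f x = 0) (hf : ContinuousAt f x) : ¬ IsLocalMax f x := by
  intro hmax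
  have hconst : f =ᶠ[nhds x] fun _ => f x := by
    filter_upwards [hmax, isLocalMin_of_deriv_deriv_pos h₂ h₁ hf] with y h h'
    exact le_antisymm h h'
  have h₀ : deriv (deriv f) x = 0 := by
    rw [hconst.deriv.deriv_eq]
    simp
  exact h₂.ne' h₀

theorem not_isLocalMin_of_deriv_deriv_neg {f : ℝ → ℝ} {x : ℝ} (h₂ : deriv (deriv f) x < 0)
    (h₁ : deriv f x = 0) (hf : ContinuousAt f x) : ¬ IsLocalMin f x := by
  intro hmin
  have hconst : f =ᶠ[nhds x] fun _ => f x := by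
    filter_upwards [hmin, isLocalMax_of_deriv_deriv_neg h₂ h₁ hf] with y h h'
    exact le_antisymm h' h
  have h₀ : deriv (deriv f) x = 0 := by
    rw [hconst.deriv.deriv_eq]
    simp
  exact h₂.ne h₀

theorem hasDerivAt_H₁_left (M₁ ν γ₁ X Y : ℝ) :
    HasDerivAt (fun X => H₁ M₁ ν γ₁ X Y) (M₁ * Real.sin X * Real.exp (-Y)) X := by
  unfold H₁
  refine HasDerivAt.congr_deriv
    (((((Real.hasDerivAt_cos X).const_mul (-M₁)).mul_const (Real.exp (-Y))).sub_const
    ((γ₁ / 2) * Y ^ 2)).sub_const (ν * Y)) ?_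
  ring

theorem hasDerivAt_exp_neg (Y : ℝ) :
    HasDerivAt (fun Y => Real.exp (-Y)) (-Real.exp (-Y)) Y := by
  simpa using (hasDerivAt_neg Y).exp

theorem hasDerivAt_H₁_right (M₁ ν γ₁ X Y : ℝ) :
    HasDerivAt (fun Y => H₁ M₁ ν γ₁ X Y)
      (M₁ * Real.cos X * Real.exp (-Y) - γ₁ * Y - ν) Y := by
  unfold H₁
  refine HasDerivAt.congr_deriv ((((hasDerivAt_exp_neg Y).const_mul (-M₁ * Real.cos X)).sub
    ((hasDerivAt_pow 2 Y).const_mul (γ₁ / 2))).sub ((hasDerivAt_id Y).const_mul ν)) ?_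
  simp
  ring

theorem deriv_deriv_H₁_left (M₁ ν γ₁ X Y : ℝ) :
    deriv (deriv (fun X => H₁ M₁ ν γ₁ X Y)) X = M₁ * Real.cos X * Real.exp (-Y) := by
  rw [funext fun X => (hasDerivAt_H₁_left M₁ ν γ₁ X Y).deriv]
  exact (((Real.hasDerivAt_sin X).const_mul M₁).mul_const _).deriv

theorem deriv_deriv_H₁_right (M₁ ν γ₁ X Y : ℝ) :
    deriv (deriv (fun Y => H₁ M₁ ν γ₁ X Y)) Y = -M₁ * Real.cos X * Real.exp (-Y) - γ₁ := by
  rw [funext fun Y => (hasDerivAt_H₁_right M₁ ν γ₁ X Y).deriv]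
  refine HasDerivAt.deriv ?_
  refine HasDerivAt.congr_deriv ((((hasDerivAt_exp_neg Y).const_mul (M₁ * Real.cos X)).sub
    ((hasDerivAt_id Y).const_mul γ₁)).sub_const ν) ?_
  ring

theorem deriv_deriv_H₁_mixed (M₁ ν γ₁ X Y : ℝ) :
    deriv (fun X => deriv (fun Y => H₁ M₁ ν γ₁ X Y) Y) X
      = -M₁ * Real.sin X * Real.exp (-Y) := by
  rw [funext fun X => (hasDerivAt_H₁_right M₁ ν γ₁ X Y).deriv]
  refine HasDerivAt.deriv ?_
  refine HasDerivAt.congr_deriv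
    (((((Real.hasDerivAt_cos X).const_mul M₁).mul_const (Real.exp (-Y))).sub_const
    (γ₁ * Y)).sub_const ν) ?_
  ring

theorem strictAnti_exp_neg_add_linear {M γ : ℝ} (ν : ℝ) (hM : 0 < M) (hγ : γ < 0) :
    StrictAnti fun Y : ℝ => M * Real.exp (-Y) + ν + γ * Y := by
  intro a b hab
  have h₁ : M * Real.exp (-b) < M * Real.exp (-a) := by gcongr
  have h₂ : γ * b < γ * a := mul_lt_mul_of_neg_left hab hγ
  dsimp only
  linarith

theorem exists_exp_neg_add_linear_eq_zero {M γ ν : ℝ} (hM : 0 < M) (hγ : γ < 0) (hν : 0 < ν) :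
    ∃ Y : ℝ, M * Real.exp (-Y) + ν + γ * Y = 0 := by
  have hb : 0 ≤ (M + ν) / -γ := by
    have := neg_pos.2 hγ
    positivity
  have hcont : ContinuousOn (fun Y : ℝ => M * Real.exp (-Y) + ν + γ * Y)
      (Set.Icc 0 ((M + ν) / -γ)) := by fun_prop
  obtain ⟨Y, -, hY⟩ := intermediate_value_Icc' hb hcont (show (0 : ℝ) ∈ _ by
    refine ⟨?_, by simp; positivity⟩
    have he : M * Real.exp (-((M + ν) / -γ)) ≤ M :=
      mul_le_of_le_one_right hM.le (Real.exp_le_one_iff.2 (neg_nonpos.2 hb))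
    have hg : γ * ((M + ν) / -γ) = -(M + ν) := by
      field_simp [hγ.ne]
    linarith)
  exact ⟨Y, hY⟩

/-- for `γ₁ < 0`, `k > 0`, `𝔠 > 0`, `M₁ > 0` there is exactly one
`Ȳ` with `M₁e^{−Ȳ} + k𝔠 + γ₁Ȳ = 0`; it is positive, and `(π,Ȳ)` is a
nondegenerate saddle of `H₁` with diagonal Hessian entries
`−M₁e^{−Ȳ} < 0` and `M₁e^{−Ȳ} − γ₁ > 0`. -/
theorem stmt6 (γ₁ k 𝔠 M₁ : ℝ) (hγ : γ₁ < 0) (hk : 0 < k) (h𝔠 : 0 < 𝔠)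
    (hM : 0 < M₁) :
    (∃! Yb : ℝ, M₁ * Real.exp (-Yb) + k * 𝔠 + γ₁ * Yb = 0) ∧
    ∀ Yb : ℝ, M₁ * Real.exp (-Yb) + k * 𝔠 + γ₁ * Yb = 0 →
      0 < Yb ∧
      deriv (deriv (fun X => H₁ M₁ (k * 𝔠) γ₁ X Yb)) Real.pi
        = -M₁ * Real.exp (-Yb) ∧
      deriv (deriv (fun Y => H₁ M₁ (k * 𝔠) γ₁ Real.pi Y)) Yb
        = M₁ * Real.exp (-Yb) - γ₁ ∧
      deriv (fun X => deriv (fun Y => H₁ M₁ (k * 𝔠) γ₁ X Y) Yb) Real.pi = 0 ∧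
      -M₁ * Real.exp (-Yb) < 0 ∧
      0 < M₁ * Real.exp (-Yb) - γ₁ ∧
      ¬ IsLocalMax (fun p : ℝ × ℝ => H₁ M₁ (k * 𝔠) γ₁ p.1 p.2) (Real.pi, Yb) ∧
      ¬ IsLocalMin (fun p : ℝ × ℝ => H₁ M₁ (k * 𝔠) γ₁ p.1 p.2) (Real.pi, Yb) := by
  have hν : 0 < k * 𝔠 := mul_pos hk h𝔠
  have hanti := strictAnti_exp_neg_add_linear (k * 𝔠) hM hγ
  refine ⟨?_, fun Y hY => ?_⟩
  · obtain ⟨Y, hY⟩ := exists_exp_neg_add_linear_eq_zero hM hγ hν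
    exact ⟨Y, hY, fun Z hZ => hanti.injective (hZ.trans hY.symm)⟩
  have hexp : 0 < M₁ * Real.exp (-Y) := mul_pos hM (Real.exp_pos _)
  have hXX : deriv (deriv (fun X => H₁ M₁ (k * 𝔠) γ₁ X Y)) Real.pi = -M₁ * Real.exp (-Y) := by
    simp [deriv_deriv_H₁_left]
  have hYY : deriv (deriv (fun Y => H₁ M₁ (k * 𝔠) γ₁ Real.pi Y)) Y
      = M₁ * Real.exp (-Y) - γ₁ := by
    simp [deriv_deriv_H₁_right]
  have hneg : -M₁ * Real.exp (-Y) < 0 := by linarith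
  have hpos : 0 < M₁ * Real.exp (-Y) - γ₁ := by linarith
  refine ⟨by nlinarith, hXX, hYY, by simp [deriv_deriv_H₁_mixed], hneg, hpos,
    fun hmax => ?_, fun hmin => ?_⟩
  · have hd := hasDerivAt_H₁_right M₁ (k * 𝔠) γ₁ Real.pi Y
    refine not_isLocalMax_of_deriv_deriv_pos (hYY ▸ hpos) ?_ hd.continuousAt
      (hmax.comp_continuous (g := fun Z : ℝ => (Real.pi, Z)) (by fun_prop))
    rw [hd.deriv, Real.cos_pi]
    linarith
  · have hd := hasDerivAt_H₁_left M₁ (k * 𝔠) γ₁ Real.pi Y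
    refine not_isLocalMin_of_deriv_deriv_neg (hXX ▸ hneg) ?_ hd.continuousAt
      (hmin.comp_continuous (g := fun X : ℝ => (X, Y)) (by fun_prop))
    simp [hd.deriv]
end

section
/- Let γ₁ < 0, k > 0, 𝔠 > 0, let ε₁ ∈ (0,1) satisfy ε₁·e^{ε₁} < 1, and set M₁ := ε₁·k𝔠. Then the equation M₁·e^{−Y} − k𝔠 − γ₁·Y = 0 has exactly two real solutions Y⁻ < 0 < Y⁺ (one strictly negative, one strictly positive), and they satisfy M₁·e^{−Y⁺} < −γ₁ < M₁·e^{−Y⁻}; consequently (0, Y⁺) is a nondegenerate local minimum of the Hamiltonian H₁ (a centre of the system) and (0, Y⁻) is a nondegenerate saddle point of H₁. -/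
theorem not_isLocalMax_of_deriv_deriv_pos_s8 {f : ℝ → ℝ} {a : ℝ} (h2 : 0 < deriv (deriv f) a)
    (h1 : deriv f a = 0) (hc : ContinuousAt f a) : ¬ IsLocalMax f a := by
  intro hmax
  have hmin := isLocalMin_of_deriv_deriv_pos h2 h1 hc
  have hconst : f =ᶠ[nhds a] fun _ => f a := by
    filter_upwards [hmax, hmin] with x hx hx' using le_antisymm hx hx'
  rw [hconst.deriv.deriv_eq] at h2
  simp at h2

theorem not_isLocalMin_of_deriv_deriv_neg_s8 {f : ℝ → ℝ} {a : ℝ} (h2 : deriv (deriv f) a < 0)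
    (h1 : deriv f a = 0) (hc : ContinuousAt f a) : ¬ IsLocalMin f a := by
  intro hmin
  have hmax := isLocalMax_of_deriv_deriv_neg h2 h1 hc
  have hconst : f =ᶠ[nhds a] fun _ => f a := by
    filter_upwards [hmax, hmin] with x hx hx' using le_antisymm hx hx'
  rw [hconst.deriv.deriv_eq] at h2
  simp at h2

section Hamiltonian

variable (M ν γ : ℝ)

theorem deriv_H₁_fst (Y : ℝ) :
    deriv (fun X => H₁ M ν γ X Y) = fun X => M * Real.sin X * Real.exp (-Y) := by
  funext X
  have h : HasDerivAt (fun X => H₁ M ν γ X Y) _ X :=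
    (((((Real.hasDerivAt_cos X).const_mul (-M)).mul_const (Real.exp (-Y))).sub_const
      ((γ / 2) * Y ^ 2)).sub_const (ν * Y))
  rw [h.deriv]
  ring

theorem deriv_H₁_snd (X : ℝ) :
    deriv (fun Y => H₁ M ν γ X Y) = fun Y => M * Real.cos X * Real.exp (-Y) - ν - γ * Y := by
  funext Y
  have h : HasDerivAt (fun Y => H₁ M ν γ X Y) _ Y :=
    ((((hasDerivAt_neg Y).exp).const_mul (-M * Real.cos X)).sub
      (((hasDerivAt_id Y).pow 2).const_mul (γ / 2))).sub ((hasDerivAt_id Y).const_mul ν)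
  rw [h.deriv]
  simp
  ring

theorem deriv_deriv_H₁_fst (Y : ℝ) :
    deriv (deriv (fun X => H₁ M ν γ X Y)) 0 = M * Real.exp (-Y) := by
  rw [deriv_H₁_fst]
  have h := ((Real.hasDerivAt_sin 0).const_mul M).mul_const (Real.exp (-Y))
  rw [h.deriv]
  simp

theorem deriv_deriv_H₁_snd (Y : ℝ) :
    deriv (deriv (fun Y => H₁ M ν γ 0 Y)) Y = -M * Real.exp (-Y) - γ := by
  rw [deriv_H₁_snd]
  have h := ((((hasDerivAt_neg Y).exp).const_mul (M * Real.cos 0)).sub_const ν).sub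
    ((hasDerivAt_id Y).const_mul γ)
  refine h.deriv.trans ?_
  simp

theorem deriv_fst_deriv_snd_H₁ (Y : ℝ) :
    deriv (fun X => deriv (fun Y => H₁ M ν γ X Y) Y) 0 = 0 := by
  simp only [deriv_H₁_snd]
  have h := ((((Real.hasDerivAt_cos 0).const_mul M).mul_const (Real.exp (-Y))).sub_const
    ν).sub_const (γ * Y)
  rw [h.deriv]
  simp

theorem continuous_H₁_fst (Y : ℝ) : Continuous fun X => H₁ M ν γ X Y := by
  unfold H₁
  fun_prop

theorem continuous_H₁_snd (X : ℝ) : Continuous fun Y => H₁ M ν γ X Y := by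
  unfold H₁
  fun_prop

variable {M ν γ}

theorem isLocalMin_H₁ {Y : ℝ} (hM : 0 < M) (hY : M * Real.exp (-Y) - ν - γ * Y = 0)
    (h2 : 0 < -M * Real.exp (-Y) - γ) :
    IsLocalMin (fun p : ℝ × ℝ => H₁ M ν γ p.1 p.2) (0, Y) := by
  have hmin : IsLocalMin (fun Y => H₁ M ν γ 0 Y) Y := by
    apply isLocalMin_of_deriv_deriv_pos
    · rwa [deriv_deriv_H₁_snd]
    · simpa [deriv_H₁_snd] using hY
    · exact (continuous_H₁_snd M ν γ 0).continuousAt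
  have hsnd : Filter.Tendsto (Prod.snd : ℝ × ℝ → ℝ) (nhds (0, Y)) (nhds Y) :=
    continuous_snd.tendsto (0, Y)
  filter_upwards [hsnd.eventually hmin] with p hp
  refine hp.trans ?_
  have := mul_nonneg (mul_pos hM (Real.exp_pos (-p.2))).le (sub_nonneg.2 (Real.cos_le_one p.1))
  simp only [H₁, Real.cos_zero]
  linarith

theorem not_isLocalMax_H₁ {Y : ℝ} (hM : 0 < M) :
    ¬ IsLocalMax (fun p : ℝ × ℝ => H₁ M ν γ p.1 p.2) (0, Y) := by
  intro h
  have hcont : Filter.Tendsto (fun X : ℝ => (X, Y)) (nhds 0) (nhds (0, Y)) :=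
    (Continuous.prodMk_left Y).tendsto 0
  refine not_isLocalMax_of_deriv_deriv_pos_s8 (f := fun X => H₁ M ν γ X Y) (a := 0) ?_ ?_
    (continuous_H₁_fst M ν γ Y).continuousAt (hcont.eventually h)
  · rw [deriv_deriv_H₁_fst]
    positivity
  · simp [deriv_H₁_fst]

theorem not_isLocalMin_H₁ {Y : ℝ} (hY : M * Real.exp (-Y) - ν - γ * Y = 0)
    (h2 : -M * Real.exp (-Y) - γ < 0) :
    ¬ IsLocalMin (fun p : ℝ × ℝ => H₁ M ν γ p.1 p.2) (0, Y) := by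
  intro h
  have hcont : Filter.Tendsto (fun Y : ℝ => ((0 : ℝ), Y)) (nhds Y) (nhds (0, Y)) :=
    (Continuous.prodMk_right (0 : ℝ)).tendsto Y
  refine not_isLocalMin_of_deriv_deriv_neg_s8 (f := fun Y => H₁ M ν γ 0 Y) (a := Y) ?_ ?_
    (continuous_H₁_snd M ν γ 0).continuousAt (hcont.eventually h)
  · rwa [deriv_deriv_H₁_snd]
  · simpa [deriv_H₁_snd] using hY

/-- The convex function `Y ↦ M e^{-Y} - ν - γ Y` lies above its tangent lines. -/
theorem tangent_le (hM : 0 < M) (a b : ℝ) :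
    M * Real.exp (-a) - ν - γ * a + (-M * Real.exp (-a) - γ) * (b - a) ≤
      M * Real.exp (-b) - ν - γ * b := by
  have h1 : Real.exp (-b) = Real.exp (-a) * Real.exp (a - b) := by
    rw [← Real.exp_add]; ring_nf
  have h2 := mul_le_mul_of_nonneg_left (Real.add_one_le_exp (a - b))
    (mul_pos hM (Real.exp_pos (-a))).le
  rw [h1]
  linarith

theorem exists_neg_root (hM : 0 < M) (hMν : M < ν) (hγ : γ < 0) :
    ∃ Y < 0, M * Real.exp (-Y) - ν - γ * Y = 0 := by
  set t := 2 * (ν - γ) / M + 1 with ht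
  have hνγ : 0 < ν - γ := by linarith
  have ht1 : 1 < t := by
    have : 0 < 2 * (ν - γ) / M := by positivity
    linarith
  have hMt : M * t = 2 * (ν - γ) + M := by rw [ht]; field_simp
  have hexp := mul_le_mul_of_nonneg_left
    (Real.quadratic_le_exp_of_nonneg (zero_le_one.trans ht1.le)) hM.le
  have hpos : 0 ≤ M * Real.exp (-(-t)) - ν - γ * (-t) := by
    rw [neg_neg]
    nlinarith [mul_pos hM (zero_lt_one.trans ht1)]
  have hcont : ContinuousOn (fun Y => M * Real.exp (-Y) - ν - γ * Y) (Set.Icc (-t) 0) := by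
    fun_prop
  obtain ⟨Y, hY, hY0⟩ := intermediate_value_Icc' (by linarith) hcont
    (show (0 : ℝ) ∈ Set.Icc _ _ from ⟨by simp; linarith, hpos⟩)
  refine ⟨Y, lt_of_le_of_ne hY.2 ?_, hY0⟩
  rintro rfl
  simp at hY0
  linarith

theorem exists_pos_root (hM : 0 < M) (hMν : M < ν) (hγ : γ < 0) :
    ∃ Y > 0, M * Real.exp (-Y) - ν - γ * Y = 0 := by
  have hnonneg : 0 ≤ ν / -γ := div_nonneg (by linarith) (by linarith)
  have hpos : 0 ≤ M * Real.exp (-(ν / -γ)) - ν - γ * (ν / -γ) := by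
    have h1 : γ * (ν / -γ) = -ν := by field_simp [hγ.ne]
    have h2 := mul_pos hM (Real.exp_pos (-(ν / -γ)))
    linarith
  have hcont : ContinuousOn (fun Y => M * Real.exp (-Y) - ν - γ * Y) (Set.Icc 0 (ν / -γ)) := by
    fun_prop
  obtain ⟨Y, hY, hY0⟩ := intermediate_value_Icc hnonneg hcont
    (show (0 : ℝ) ∈ Set.Icc _ _ from ⟨by simp; linarith, hpos⟩)
  refine ⟨Y, lt_of_le_of_ne hY.1 ?_, hY0⟩
  rintro rfl
  simp at hY0
  linarith

theorem slope_pos_of_pos_root (hM : 0 < M) (hMν : M < ν) {Y : ℝ} (hY : 0 < Y)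
    (h : M * Real.exp (-Y) - ν - γ * Y = 0) : 0 < -M * Real.exp (-Y) - γ := by
  have ht := tangent_le (ν := ν) (γ := γ) hM Y 0
  rw [h] at ht
  simp only [neg_zero, Real.exp_zero] at ht
  by_contra! hle
  nlinarith

theorem slope_neg_of_neg_root (hM : 0 < M) (hMν : M < ν) {Y : ℝ} (hY : Y < 0)
    (h : M * Real.exp (-Y) - ν - γ * Y = 0) : -M * Real.exp (-Y) - γ < 0 := by
  have ht := tangent_le (ν := ν) (γ := γ) hM Y 0
  rw [h] at ht
  simp only [neg_zero, Real.exp_zero] at ht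
  by_contra! hle
  nlinarith

theorem pos_root_le (hM : 0 < M) (hMν : M < ν) {a b : ℝ} (ha : 0 < a)
    (h : M * Real.exp (-a) - ν - γ * a = 0) (h' : M * Real.exp (-b) - ν - γ * b = 0) :
    b ≤ a := by
  have hs := slope_pos_of_pos_root hM hMν ha h
  have ht := tangent_le (ν := ν) (γ := γ) hM a b
  rw [h, h', zero_add] at ht
  linarith [nonpos_of_mul_nonpos_right ht hs]

theorem le_neg_root (hM : 0 < M) (hMν : M < ν) {a b : ℝ} (ha : a < 0)
    (h : M * Real.exp (-a) - ν - γ * a = 0) (h' : M * Real.exp (-b) - ν - γ * b = 0) :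
    a ≤ b := by
  have hs := slope_neg_of_neg_root hM hMν ha h
  have ht := tangent_le (ν := ν) (γ := γ) hM a b
  rw [h, h', zero_add] at ht
  by_contra! hlt
  nlinarith [mul_pos_of_neg_of_neg hs (sub_neg.2 hlt)]

end Hamiltonian

/-- for `γ₁ < 0`, `k, 𝔠 > 0`, `ε₁ ∈ (0,1)` with `ε₁e^{ε₁} < 1`
and `M₁ = ε₁k𝔠`, the equation `M₁e^{−Y} − k𝔠 − γ₁Y = 0` has exactly two real
solutions `Y⁻ < 0 < Y⁺` with `M₁e^{−Y⁺} < −γ₁ < M₁e^{−Y⁻}`; `(0,Y⁺)` is a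
nondegenerate local minimum (centre) of `H₁` and `(0,Y⁻)` a nondegenerate
saddle. -/
theorem stmt8 (γ₁ k 𝔠 ε₁ M₁ : ℝ) (hγ : γ₁ < 0) (hk : 0 < k) (h𝔠 : 0 < 𝔠)
    (hε : 0 < ε₁) (hε1 : ε₁ < 1) (hcond : ε₁ * Real.exp ε₁ < 1)
    (hM : M₁ = ε₁ * (k * 𝔠)) :
    ∃ Ym Yp : ℝ, Ym < 0 ∧ 0 < Yp ∧
      M₁ * Real.exp (-Ym) - k * 𝔠 - γ₁ * Ym = 0 ∧
      M₁ * Real.exp (-Yp) - k * 𝔠 - γ₁ * Yp = 0 ∧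
      (∀ Y : ℝ, M₁ * Real.exp (-Y) - k * 𝔠 - γ₁ * Y = 0 → Y = Ym ∨ Y = Yp) ∧
      M₁ * Real.exp (-Yp) < -γ₁ ∧ -γ₁ < M₁ * Real.exp (-Ym) ∧
      deriv (deriv (fun X => H₁ M₁ (k * 𝔠) γ₁ X Yp)) 0 = M₁ * Real.exp (-Yp) ∧
      deriv (deriv (fun Y => H₁ M₁ (k * 𝔠) γ₁ 0 Y)) Yp
        = -M₁ * Real.exp (-Yp) - γ₁ ∧
      deriv (fun X => deriv (fun Y => H₁ M₁ (k * 𝔠) γ₁ X Y) Yp) 0 = 0 ∧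
      0 < M₁ * Real.exp (-Yp) ∧ 0 < -M₁ * Real.exp (-Yp) - γ₁ ∧
      IsLocalMin (fun p : ℝ × ℝ => H₁ M₁ (k * 𝔠) γ₁ p.1 p.2) (0, Yp) ∧
      deriv (deriv (fun X => H₁ M₁ (k * 𝔠) γ₁ X Ym)) 0 = M₁ * Real.exp (-Ym) ∧
      deriv (deriv (fun Y => H₁ M₁ (k * 𝔠) γ₁ 0 Y)) Ym
        = -M₁ * Real.exp (-Ym) - γ₁ ∧
      deriv (fun X => deriv (fun Y => H₁ M₁ (k * 𝔠) γ₁ X Y) Ym) 0 = 0 ∧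
      0 < M₁ * Real.exp (-Ym) ∧ -M₁ * Real.exp (-Ym) - γ₁ < 0 ∧
      ¬ IsLocalMax (fun p : ℝ × ℝ => H₁ M₁ (k * 𝔠) γ₁ p.1 p.2) (0, Ym) ∧
      ¬ IsLocalMin (fun p : ℝ × ℝ => H₁ M₁ (k * 𝔠) γ₁ p.1 p.2) (0, Ym) := by
  have hν : 0 < k * 𝔠 := mul_pos hk h𝔠
  have hM0 : 0 < M₁ := hM ▸ mul_pos hε hν
  have hMν : M₁ < k * 𝔠 := by rw [hM]; exact mul_lt_of_lt_one_left hν hε1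
  obtain ⟨Ym, hm, hm0⟩ := exists_neg_root hM0 hMν hγ
  obtain ⟨Yp, hp, hp0⟩ := exists_pos_root hM0 hMν hγ
  have hsm := slope_neg_of_neg_root hM0 hMν hm hm0
  have hsp := slope_pos_of_pos_root hM0 hMν hp hp0
  refine ⟨Ym, Yp, hm, hp, hm0, hp0, fun Y hY => ?_, by linarith, by linarith,
    deriv_deriv_H₁_fst _ _ _ _, deriv_deriv_H₁_snd _ _ _ _, deriv_fst_deriv_snd_H₁ _ _ _ _,
    by positivity, hsp, isLocalMin_H₁ hM0 hp0 hsp,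
    deriv_deriv_H₁_fst _ _ _ _, deriv_deriv_H₁_snd _ _ _ _, deriv_fst_deriv_snd_H₁ _ _ _ _,
    by positivity, hsm, not_isLocalMax_H₁ hM0, not_isLocalMin_H₁ hm0 hsm⟩
  rcases lt_trichotomy Y 0 with h | rfl | h
  · exact .inl (le_antisymm (le_neg_root hM0 hMν h hY hm0) (le_neg_root hM0 hMν hm hm0 hY))
  · simp at hY
    linarith
  · exact .inr (le_antisymm (pos_root_le hM0 hMν hp hp0 hY) (pos_root_le hM0 hMν h hY hp0))
end

section
/- Let A ∈ (−1,1), k > 0, 𝔠 > 0, γ₁ < 0, ε₁ ∈ (0,1), set M₁ := ε₁·k𝔠 and ℜ := √(1−A²)·M₁/γ₁, and assume −1 < ℜ < 0, arcosh(1/|ℜ|) − tanh(arcosh(1/|ℜ|)) > |k𝔠/γ₁ + (1/2)·log((1+A)/(1−A))|, and k𝔠 ≠ −(γ₁/2)·log((1+A)/(1−A)). Then the set of singular points {(X,Y) ∈ [−π,π]×ℝ : F(X,Y) = 0 and G(X,Y) = 0} has exactly 5 elements; more precisely, all singular points satisfy X ∈ {−π, 0, π}, the function Y ↦ F(0,Y)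 has exactly three real zeros, and the function Y ↦ F(π,Y) = F(−π,Y) has exactly one real zero. -/
/-- The inverse hyperbolic cosine (principal branch), for `x ≥ 1`. -/
noncomputable def arcosh (x : ℝ) : ℝ :=
  Real.log (x + Real.sqrt (x ^ 2 - 1))

/-- Horizontal velocity `F(X,Y) = M₁ cos X (A cosh Y − sinh Y) − ν − γ₁Y`
of the upper-layer travelling-wave system, with `ν = k𝔠`. -/
noncomputable def Fup (M₁ ν γ₁ A X Y : ℝ) : ℝ :=
  M₁ * Real.cos X * (A * Real.cosh Y - Real.sinh Y) - ν - γ₁ * Y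

/-- Vertical velocity `G(X,Y) = M₁ sin X (A sinh Y − cosh Y)`. -/
noncomputable def Gup (M₁ A X Y : ℝ) : ℝ :=
  M₁ * Real.sin X * (A * Real.sinh Y - Real.cosh Y)

theorem Real.sinh_ge_quadratic {x : ℝ} (hx : 0 ≤ x) : x ^ 2 / 4 ≤ Real.sinh x := by
  have h₁ := Real.quadratic_le_exp_of_nonneg hx
  have h₂ : Real.exp (-x) ≤ 1 := Real.exp_le_one_iff.mpr (by linarith)
  rw [Real.sinh_eq]
  linarith

theorem exists_gt_sub_mul_sinh_neg {r : ℝ} (hr : 0 < r) (c b : ℝ) (hc : 0 < c) :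
    ∃ z, c < z ∧ z - r * Real.sinh z + b < 0 := by
  have hb := abs_nonneg b
  have hq : 0 < 4 * (2 + |b|) / r := by positivity
  refine ⟨4 * (2 + |b|) / r + 1 + c, by linarith, ?_⟩
  set z := 4 * (2 + |b|) / r + 1 + c with hz
  have hz1 : 1 ≤ z := by linarith
  have hrz : 4 * (2 + |b|) ≤ r * z := by
    have h : r * (4 * (2 + |b|) / r) = 4 * (2 + |b|) := by field_simp
    have h' : r * z = r * (4 * (2 + |b|) / r) + r * (1 + c) := by rw [hz]; ring
    have : 0 < r * (1 + c) := by positivity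
    linarith
  have hs : r * (z ^ 2 / 4) ≤ r * Real.sinh z :=
    mul_le_mul_of_nonneg_left (Real.sinh_ge_quadratic (by linarith)) hr.le
  have hm : 4 * (2 + |b|) * z ≤ r * z * z := mul_le_mul_of_nonneg_right hrz (by linarith)
  have hbz : |b| ≤ |b| * z := le_mul_of_one_le_right hb hz1
  have := le_abs_self b
  nlinarith

theorem hasDerivAt_sub_mul_sinh (r b z : ℝ) :
    HasDerivAt (fun z => z - r * Real.sinh z + b) (1 - r * Real.cosh z) z :=
  ((hasDerivAt_id z).sub ((Real.hasDerivAt_sinh z).const_mul r)).add_const b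

theorem continuous_sub_mul_sinh (r b : ℝ) :
    Continuous (fun z => z - r * Real.sinh z + b) := by
  have := Real.continuous_sinh
  fun_prop

theorem strictAntiOn_sub_mul_sinh {r c : ℝ} (hr : 0 < r) (hc : 0 < c)
    (hrc : r * Real.cosh c = 1) (b : ℝ) :
    StrictAntiOn (fun z => z - r * Real.sinh z + b) (Set.Ici c) := by
  refine strictAntiOn_of_deriv_neg (convex_Ici c) (continuous_sub_mul_sinh r b).continuousOn ?_
  intro z hz
  rw [interior_Ici] at hz
  have hz : c < z := hz
  rw [(hasDerivAt_sub_mul_sinh r b z).deriv]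
  have : Real.cosh c < Real.cosh z := by
    rw [Real.cosh_lt_cosh, abs_of_pos hc, abs_of_pos (hc.trans hz)]
    exact hz
  nlinarith

theorem strictAntiOn_sub_mul_sinh_Iic {r c : ℝ} (hr : 0 < r) (hc : 0 < c)
    (hrc : r * Real.cosh c = 1) (b : ℝ) :
    StrictAntiOn (fun z => z - r * Real.sinh z + b) (Set.Iic (-c)) := by
  intro x hx y hy hxy
  have hx : x ≤ -c := hx
  have hy : y ≤ -c := hy
  have h := strictAntiOn_sub_mul_sinh hr hc hrc (-b) (show -y ∈ Set.Ici c from le_neg.mpr hy)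
    (show -x ∈ Set.Ici c from le_neg.mpr hx) (neg_lt_neg hxy)
  simp only [Real.sinh_neg] at h ⊢
  linarith

theorem strictMonoOn_sub_mul_sinh {r c : ℝ} (hr : 0 < r) (hc : 0 < c)
    (hrc : r * Real.cosh c = 1) (b : ℝ) :
    StrictMonoOn (fun z => z - r * Real.sinh z + b) (Set.Icc (-c) c) := by
  refine strictMonoOn_of_deriv_pos (convex_Icc _ c) (continuous_sub_mul_sinh r b).continuousOn ?_
  intro z hz
  rw [interior_Icc] at hz
  rw [(hasDerivAt_sub_mul_sinh r b z).deriv]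
  have : Real.cosh z < Real.cosh c := by
    rw [Real.cosh_lt_cosh, abs_of_pos hc]
    exact abs_lt.mpr hz
  nlinarith

theorem ncard_zeros_sub_mul_sinh {r c b : ℝ} (hr : 0 < r) (hc : 0 < c)
    (hrc : r * Real.cosh c = 1) (hb : |b| < c - r * Real.sinh c) :
    {z : ℝ | z - r * Real.sinh z + b = 0}.ncard = 3 := by
  obtain ⟨hb₁, hb₂⟩ := abs_lt.mp hb
  have hcont := continuous_sub_mul_sinh r b
  have hanti := strictAntiOn_sub_mul_sinh hr hc hrc b
  have hanti' := strictAntiOn_sub_mul_sinh_Iic hr hc hrc b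
  have hmono := strictMonoOn_sub_mul_sinh hr hc hrc b
  have hpos : 0 < c - r * Real.sinh c + b := by linarith
  have hneg : -c - r * Real.sinh (-c) + b < 0 := by rw [Real.sinh_neg]; linarith
  obtain ⟨v, hcv, hv⟩ := exists_gt_sub_mul_sinh_neg hr c b hc
  obtain ⟨u, hcu, hu⟩ := exists_gt_sub_mul_sinh_neg hr c (-b) hc
  have hu : 0 < -u - r * Real.sinh (-u) + b := by rw [Real.sinh_neg]; linarith
  obtain ⟨z₁, ⟨_, h₁⟩, hz₁⟩ :=
    intermediate_value_Ioo' (show -u ≤ -c by linarith) hcont.continuousOn ⟨hneg, hu⟩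
  obtain ⟨z₂, ⟨h₂, h₂'⟩, hz₂⟩ :=
    intermediate_value_Ioo (show -c ≤ c by linarith) hcont.continuousOn ⟨hneg, hpos⟩
  obtain ⟨z₃, ⟨h₃, _⟩, hz₃⟩ :=
    intermediate_value_Ioo' hcv.le hcont.continuousOn ⟨hv, hpos⟩
  refine Set.ncard_eq_three.mpr ⟨z₁, z₂, z₃, by linarith, by linarith, by linarith, ?_⟩
  ext z
  simp only [Set.mem_ofPred_eq, Set.mem_insert_iff, Set.mem_singleton_iff]
  constructor
  · intro hz
    rcases le_total z (-c) with h | h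
    · exact Or.inl (hanti'.injOn h h₁.le (hz.trans hz₁.symm))
    · rcases le_total z c with h' | h'
      · exact Or.inr (Or.inl (hmono.injOn ⟨h, h'⟩ ⟨h₂.le, h₂'.le⟩ (hz.trans hz₂.symm)))
      · exact Or.inr (Or.inr (hanti.injOn h' h₃.le (hz.trans hz₃.symm)))
  · rintro (rfl | rfl | rfl)
    exacts [hz₁, hz₂, hz₃]

theorem ncard_zeros_add_mul_sinh {r : ℝ} (hr : 0 < r) (b : ℝ) :
    {z : ℝ | z + r * Real.sinh z + b = 0}.ncard = 1 := by
  have hmono : StrictMono fun z => z + r * Real.sinh z + b := by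
    intro x y hxy
    have := mul_lt_mul_of_pos_left (Real.sinh_lt_sinh.mpr hxy) hr
    dsimp only
    linarith
  have hcont : Continuous fun z => z + r * Real.sinh z + b := by
    have := Real.continuous_sinh
    fun_prop
  have h₁ : 0 ≤ |b| + r * Real.sinh |b| + b := by
    have := mul_nonneg hr.le (Real.sinh_nonneg_iff.mpr (abs_nonneg b))
    linarith [neg_abs_le b]
  have h₂ : -|b| + r * Real.sinh (-|b|) + b ≤ 0 := by
    have := mul_nonneg hr.le (Real.sinh_nonneg_iff.mpr (abs_nonneg b))
    rw [Real.sinh_neg]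
    linarith [le_abs_self b]
  obtain ⟨z, -, hz⟩ := intermediate_value_Icc (show -|b| ≤ |b| by linarith [abs_nonneg b])
    hcont.continuousOn ⟨h₂, h₁⟩
  refine Set.ncard_eq_one.mpr ⟨z, ?_⟩
  ext w
  simp only [Set.mem_ofPred_eq, Set.mem_singleton_iff]
  exact ⟨fun hw => hmono.injective (hw.trans hz.symm), fun hw => hw ▸ hz⟩

theorem Set.ncard_setOf_comp_sub (p : ℝ → Prop) (a : ℝ) :
    {y : ℝ | p (y - a)}.ncard = {z : ℝ | p z}.ncard := by
  rw [← Set.ncard_image_of_injective {z : ℝ | p z} (add_left_injective a)]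
  congr 1
  ext y
  simp only [Set.mem_ofPred_eq, Set.mem_image]
  exact ⟨fun h => ⟨y - a, h, by ring⟩, by rintro ⟨z, hz, rfl⟩; simpa using hz⟩

theorem mul_cosh_sub_sinh_eq {A : ℝ} (hA : -1 < A) (hA' : A < 1) (y : ℝ) :
    A * Real.cosh y - Real.sinh y =
      -(Real.sqrt (1 - A ^ 2) *
        Real.sinh (y - (1 / 2) * Real.log ((1 + A) / (1 - A)))) := by
  have hp : 0 < 1 + A := by linarith
  have hm : 0 < 1 - A := by linarith
  have hs : Real.sqrt (1 - A ^ 2) = Real.sqrt (1 + A) * Real.sqrt (1 - A) := by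
    rw [← Real.sqrt_mul hp.le]
    ring_nf
  have he : Real.exp ((1 / 2) * Real.log ((1 + A) / (1 - A))) =
      Real.sqrt (1 + A) / Real.sqrt (1 - A) := by
    rw [← Real.sqrt_div hp.le, Real.sqrt_eq_rpow, Real.rpow_def_of_pos (by positivity), mul_comm]
  have hp' := Real.sqrt_pos.mpr hp
  have hm' := Real.sqrt_pos.mpr hm
  have hps := Real.sq_sqrt hp.le
  have hms := Real.sq_sqrt hm.le
  rw [hs, Real.sinh_eq (_ - _), neg_sub, Real.exp_sub y, Real.exp_sub _ y, he,
    Real.cosh_eq, Real.sinh_eq, Real.exp_neg y]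
  field_simp
  rw [hps, hms]
  ring

theorem arcosh_pos_of_one_lt {x : ℝ} (hx : 1 < x) : 0 < arcosh x :=
  Real.log_pos (by linarith [Real.sqrt_nonneg (x ^ 2 - 1)])

theorem cosh_arcosh_of_one_le {x : ℝ} (hx : 1 ≤ x) : Real.cosh (arcosh x) = x := by
  have hs := Real.sqrt_nonneg (x ^ 2 - 1)
  have hsq := Real.sq_sqrt (show 0 ≤ x ^ 2 - 1 by nlinarith)
  have hpos : 0 < x + Real.sqrt (x ^ 2 - 1) := by linarith
  rw [arcosh, Real.cosh_log hpos]
  field_simp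
  linarith

theorem mul_sinh_sub_cosh_neg {A : ℝ} (hA : -1 < A) (hA' : A < 1) (y : ℝ) :
    A * Real.sinh y - Real.cosh y < 0 := by
  have h₁ := mul_pos (show 0 < 1 + A by linarith) (Real.exp_pos (-y))
  have h₂ := mul_pos (show 0 < 1 - A by linarith) (Real.exp_pos y)
  rw [Real.sinh_eq, Real.cosh_eq]
  linarith

theorem sin_eq_zero_of_Gup_eq_zero {M₁ A X Y : ℝ} (hM : M₁ ≠ 0) (hA : -1 < A) (hA' : A < 1)
    (h : Gup M₁ A X Y = 0) : Real.sin X = 0 := by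
  have hn := (mul_sinh_sub_cosh_neg hA hA' Y).ne
  simpa [Gup, hM, hn] using h

theorem eq_of_sin_eq_zero_of_mem_Icc {x : ℝ} (hx : x ∈ Set.Icc (-Real.pi) Real.pi)
    (h : Real.sin x = 0) : x = -Real.pi ∨ x = 0 ∨ x = Real.pi := by
  rcases hx.1.eq_or_lt with h₁ | h₁
  · exact Or.inl h₁.symm
  rcases hx.2.eq_or_lt with h₂ | h₂
  · exact Or.inr (Or.inr h₂)
  exact Or.inr (Or.inl ((Real.sin_eq_zero_iff_of_lt_of_lt h₁ h₂).mp h))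

/-- for `|A| < 1`, `γ₁ < 0`, `𝔠 > 0`, `−1 < ℜ < 0` under the
stated conditions, the system has exactly `5` singular points in
`[−π,π] × ℝ`: all lie on `X ∈ {−π,0,π}`, with `F(0,·)` having three zeros and
`F(±π,·)` one. -/
theorem stmt14 (A k 𝔠 γ₁ ε₁ M₁ R : ℝ) (hA : -1 < A) (hA' : A < 1)
    (hk : 0 < k) (h𝔠 : 0 < 𝔠) (hγ : γ₁ < 0) (hε : 0 < ε₁) (hε1 : ε₁ < 1)
    (hM : M₁ = ε₁ * (k * 𝔠)) (hR : R = Real.sqrt (1 - A ^ 2) * M₁ / γ₁)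
    (hR0 : -1 < R) (hR1 : R < 0)
    (hcond : arcosh (1 / |R|) - Real.tanh (arcosh (1 / |R|)) >
      |k * 𝔠 / γ₁ + (1 / 2) * Real.log ((1 + A) / (1 - A))|)
    (hne : k * 𝔠 ≠ -(γ₁ / 2) * Real.log ((1 + A) / (1 - A))) :
    {p : ℝ × ℝ | p.1 ∈ Set.Icc (-Real.pi) Real.pi ∧
        Fup M₁ (k * 𝔠) γ₁ A p.1 p.2 = 0 ∧ Gup M₁ A p.1 p.2 = 0}.ncard = 5 ∧
    (∀ p : ℝ × ℝ, p.1 ∈ Set.Icc (-Real.pi) Real.pi →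
        Fup M₁ (k * 𝔠) γ₁ A p.1 p.2 = 0 → Gup M₁ A p.1 p.2 = 0 →
        p.1 = -Real.pi ∨ p.1 = 0 ∨ p.1 = Real.pi) ∧
    {Y : ℝ | Fup M₁ (k * 𝔠) γ₁ A 0 Y = 0}.ncard = 3 ∧
    (∀ Y : ℝ, Fup M₁ (k * 𝔠) γ₁ A Real.pi Y
        = Fup M₁ (k * 𝔠) γ₁ A (-Real.pi) Y) ∧
    {Y : ℝ | Fup M₁ (k * 𝔠) γ₁ A Real.pi Y = 0}.ncard = 1 := by
  have hν : 0 < k * 𝔠 := mul_pos hk h𝔠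
  have hMpos : 0 < M₁ := hM ▸ mul_pos hε hν
  have hr : 0 < -R := by linarith
  have hx : 1 < 1 / |R| := by
    rw [abs_of_neg hR1]
    exact one_lt_one_div hr (by linarith)
  have hc := arcosh_pos_of_one_lt hx
  have hcosh := cosh_arcosh_of_one_le hx.le
  generalize arcosh (1 / |R|) = c at hc hcosh hcond
  rw [abs_of_neg hR1] at hcosh
  have hrc : -R * Real.cosh c = 1 := by
    rw [hcosh, mul_one_div_cancel hr.ne']
  have htanh : Real.tanh c = -R * Real.sinh c := by
    rw [Real.tanh_eq_sinh_div_cosh, div_eq_iff (Real.cosh_pos c).ne']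
    linear_combination -Real.sinh c * hrc
  have hlin := mul_cosh_sub_sinh_eq hA hA'
  generalize (1 / 2) * Real.log ((1 + A) / (1 - A)) = a at hcond hlin
  have hRγ : γ₁ * R = Real.sqrt (1 - A ^ 2) * M₁ := by
    rw [hR, mul_div_cancel₀ _ hγ.ne]
  have hνγ : γ₁ * (k * 𝔠 / γ₁) = k * 𝔠 := mul_div_cancel₀ _ hγ.ne
  have hF0 : ∀ Y, Fup M₁ (k * 𝔠) γ₁ A 0 Y = 0 ↔
      (Y - a) - -R * Real.sinh (Y - a) + (k * 𝔠 / γ₁ + a) = 0 := by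
    intro Y
    have h : Fup M₁ (k * 𝔠) γ₁ A 0 Y =
        -γ₁ * ((Y - a) - -R * Real.sinh (Y - a) + (k * 𝔠 / γ₁ + a)) := by
      rw [Fup, hlin, Real.cos_zero]
      linear_combination Real.sinh (Y - a) * hRγ + hνγ
    rw [h, mul_eq_zero, or_iff_right (neg_ne_zero.mpr hγ.ne)]
  have hFpi : ∀ Y, Fup M₁ (k * 𝔠) γ₁ A Real.pi Y = 0 ↔
      (Y - a) + -R * Real.sinh (Y - a) + (k * 𝔠 / γ₁ + a) = 0 := by
    intro Y
    have h : Fup M₁ (k * 𝔠) γ₁ A Real.pi Y =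
        -γ₁ * ((Y - a) + -R * Real.sinh (Y - a) + (k * 𝔠 / γ₁ + a)) := by
      rw [Fup, hlin, Real.cos_pi]
      linear_combination -Real.sinh (Y - a) * hRγ + hνγ
    rw [h, mul_eq_zero, or_iff_right (neg_ne_zero.mpr hγ.ne)]
  have hthree : {Y : ℝ | Fup M₁ (k * 𝔠) γ₁ A 0 Y = 0}.ncard = 3 := by
    simp only [hF0]
    rw [Set.ncard_setOf_comp_sub (fun z => z - -R * Real.sinh z + (k * 𝔠 / γ₁ + a) = 0)]
    exact ncard_zeros_sub_mul_sinh hr hc hrc (htanh ▸ hcond)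
  have hone : {Y : ℝ | Fup M₁ (k * 𝔠) γ₁ A Real.pi Y = 0}.ncard = 1 := by
    simp only [hFpi]
    rw [Set.ncard_setOf_comp_sub (fun z => z + -R * Real.sinh z + (k * 𝔠 / γ₁ + a) = 0)]
    exact ncard_zeros_add_mul_sinh hr _
  have hsymm : ∀ Y, Fup M₁ (k * 𝔠) γ₁ A Real.pi Y = Fup M₁ (k * 𝔠) γ₁ A (-Real.pi) Y := by
    intro Y
    rw [Fup, Fup, Real.cos_neg]
  have hsing : ∀ p : ℝ × ℝ, p.1 ∈ Set.Icc (-Real.pi) Real.pi →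
      Gup M₁ A p.1 p.2 = 0 → p.1 = -Real.pi ∨ p.1 = 0 ∨ p.1 = Real.pi := fun p hp hG =>
    eq_of_sin_eq_zero_of_mem_Icc hp (sin_eq_zero_of_Gup_eq_zero hMpos.ne' hA hA' hG)
  refine ⟨?_, fun p hp _ hG => hsing p hp hG, hthree, hsymm, hone⟩
  obtain ⟨z₁, z₂, z₃, h₁₂, h₁₃, h₂₃, hz⟩ := Set.ncard_eq_three.mp hthree
  obtain ⟨w, hw⟩ := Set.ncard_eq_one.mp hone
  have hz' : ∀ Y, Fup M₁ (k * 𝔠) γ₁ A 0 Y = 0 ↔ Y = z₁ ∨ Y = z₂ ∨ Y = z₃ := fun Y => by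
    simpa using Set.ext_iff.mp hz Y
  have hw' : ∀ Y, Fup M₁ (k * 𝔠) γ₁ A Real.pi Y = 0 ↔ Y = w := fun Y => by
    simpa using Set.ext_iff.mp hw Y
  have hπ := Real.pi_pos
  have hset : {p : ℝ × ℝ | p.1 ∈ Set.Icc (-Real.pi) Real.pi ∧
      Fup M₁ (k * 𝔠) γ₁ A p.1 p.2 = 0 ∧ Gup M₁ A p.1 p.2 = 0} =
      (({(-Real.pi, w), (Real.pi, w), (0, z₁), (0, z₂), (0, z₃)} : Finset (ℝ × ℝ)) :
        Set (ℝ × ℝ)) := by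
    ext ⟨X, Y⟩
    simp only [Set.mem_ofPred_eq, Finset.coe_insert, Finset.coe_singleton, Set.mem_insert_iff,
      Set.mem_singleton_iff, Prod.mk.injEq]
    constructor
    · rintro ⟨hX, hF, hG⟩
      rcases hsing (X, Y) hX hG with h | h | h <;> dsimp only at h <;> subst h
      · exact Or.inl ⟨rfl, (hw' Y).mp (hsymm Y ▸ hF)⟩
      · simpa [hπ.ne] using (hz' Y).mp hF
      · exact Or.inr (Or.inl ⟨rfl, (hw' Y).mp hF⟩)
    · have hzero : (0 : ℝ) ∈ Set.Icc (-Real.pi) Real.pi := ⟨by linarith, hπ.le⟩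
      have hG0 : ∀ Y, Gup M₁ A 0 Y = 0 := fun Y => by simp [Gup]
      rintro (⟨rfl, rfl⟩ | ⟨rfl, rfl⟩ | ⟨rfl, rfl⟩ | ⟨rfl, rfl⟩ | ⟨rfl, rfl⟩)
      · exact ⟨⟨le_rfl, by linarith⟩, hsymm _ ▸ (hw' _).mpr rfl, by simp [Gup]⟩
      · exact ⟨⟨by linarith, le_rfl⟩, (hw' _).mpr rfl, by simp [Gup]⟩
      · exact ⟨hzero, (hz' _).mpr (by simp), hG0 _⟩
      · exact ⟨hzero, (hz' _).mpr (by simp), hG0 _⟩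
      · exact ⟨hzero, (hz' _).mpr (by simp), hG0 _⟩
  have hne₁ : -Real.pi ≠ Real.pi := by linarith
  rw [hset, Set.ncard_coe_finset]
  simp [Finset.card_insert_of_notMem, h₁₂, h₁₃, h₂₃, hπ.ne', hne₁]
end

section
/- Let A > 1, k > 0, 𝔠 > 0, γ₁ > 0, ε₁ ∈ (0,1), set M₁ := ε₁·k𝔠, L̃ := (1/2)·log((A+1)/(A−1)) and R̃ := M₁·√(A²−1)/γ₁, and assume arsinh(1/R̃) − coth(arsinh(1/R̃)) > k𝔠/γ₁ + L̃ together with F(0,−ε₁) < 0. Then the set of singular points {(X,Y) ∈ [−π,π]×ℝ : F(X,Y) = 0 and G(X,Y) = 0} has exactly 6 elements; more precisely, the function Y ↦ F(0,Y) has exactly two real zeros, the function Y ↦ F(π,Y) = F(−π,Y) has exactly two real zeros, and F(X, L̃) ≠ 0 for every X with sin X ≠ 0, so no singular points occur on the line Y = L̃ away from X ∈ {−π, 0, π}. -/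
/-- The hyperbolic cotangent `coth x = cosh x / sinh x`. -/
noncomputable def coth (x : ℝ) : ℝ :=
  Real.cosh x / Real.sinh x

theorem StrictConvexOn.ncard_zeros_eq_two {f : ℝ → ℝ} (hf : StrictConvexOn ℝ Set.univ f)
    (hc : Continuous f) {p m q : ℝ} (hpm : p < m) (hmq : m < q) (hp : 0 < f p) (hm : f m < 0)
    (hq : 0 < f q) : {y | f y = 0}.ncard = 2 := by
  obtain ⟨u, ⟨-, hu⟩, hfu⟩ := intermediate_value_Ioo' hpm.le hc.continuousOn ⟨hm, hp⟩
  obtain ⟨v, ⟨hv, -⟩, hfv⟩ := intermediate_value_Ioo hmq.le hc.continuousOn ⟨hm, hq⟩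
  have no_three : ∀ x y z : ℝ, x < y → y < z → f x = 0 → f y = 0 → f z ≠ 0 := by
    intro x y z hxy hyz hx hy hz
    have h := hf.slope_strict_mono_adjacent (Set.mem_univ x) (Set.mem_univ z) hxy hyz
    simp [hx, hy, hz] at h
  have huv : u < v := hu.trans hv
  refine Set.ncard_eq_two.2 ⟨u, v, huv.ne, Set.ext fun y => ⟨fun hy => ?_, ?_⟩⟩
  · rw [Set.mem_ofPred_eq] at hy
    by_contra hne
    simp only [Set.mem_insert_iff, Set.mem_singleton_iff, not_or] at hne
    rcases lt_or_gt_of_ne hne.1 with h | h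
    · exact no_three y u v h huv hy hfu hfv
    · rcases lt_or_gt_of_ne hne.2 with h' | h'
      · exact no_three u y v h h' hfu hy hfv
      · exact no_three u v y huv h' hfu hfv hy
  · rintro (rfl | rfl)
    exacts [hfu, hfv]

theorem Real.quadratic_le_two_mul_cosh (x : ℝ) : x ^ 2 / 2 ≤ 2 * Real.cosh x := by
  have h := Real.quadratic_le_exp_of_nonneg (abs_nonneg x)
  have h' : Real.exp |x| ≤ 2 * Real.cosh x := by
    rw [← Real.cosh_abs x, Real.cosh_eq]
    linarith [Real.exp_pos (-|x|)]
  rw [sq_abs] at h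
  linarith [abs_nonneg x]

theorem ncard_zeros_cosh_add_linear {a b c L m : ℝ} (ha : 0 < a)
    (hm : a * Real.cosh (m - L) + b * m + c < 0) :
    {y | a * Real.cosh (y - L) + b * y + c = 0}.ncard = 2 := by
  have hconv : StrictConvexOn ℝ Set.univ fun y => a * Real.cosh (y - L) + b * y + c := by
    refine strictConvexOn_univ_of_deriv2_pos (by fun_prop) fun x => ?_
    have h1 : deriv (fun y => a * Real.cosh (y - L) + b * y + c)
        = fun y => a * Real.sinh (y - L) + b := by
      funext y
      have h := (((((hasDerivAt_id y).sub_const L).cosh.const_mul a).add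
        ((hasDerivAt_id y).const_mul b)).add_const c).deriv
      simpa using h
    have h2 : deriv (fun y => a * Real.sinh (y - L) + b) x = a * Real.cosh (x - L) := by
      simp
    simp only [Function.iterate_succ, Function.iterate_zero, Function.comp_apply, id, h1, h2]
    exact mul_pos ha (Real.cosh_pos _)
  have pos_of_large : ∀ t : ℝ, 4 * (|b| + |b * L + c|) / a + 1 ≤ |t| →
      0 < a * Real.cosh (t + L - L) + b * (t + L) + c := by
    intro t ht
    have hB : 0 ≤ |b| + |b * L + c| := by positivity
    have h1 : 1 ≤ |t| := by
      have : 0 ≤ 4 * (|b| + |b * L + c|) / a := by positivity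
      linarith
    have h2 : 4 * (|b| + |b * L + c|) + a ≤ a * |t| := by
      have := mul_le_mul_of_nonneg_left ht ha.le
      field_simp at this
      linarith
    have h3 : (4 * (|b| + |b * L + c|) + a) * |t| ≤ a * t ^ 2 := by
      rw [← sq_abs t]
      nlinarith
    have h4 := mul_le_mul_of_nonneg_left (Real.quadratic_le_two_mul_cosh t) ha.le
    have h5 : -(|b| * |t|) ≤ b * t := by
      rw [← abs_mul]
      exact neg_abs_le _
    have h6 := neg_abs_le (b * L + c)
    have h7 := mul_le_mul_of_nonneg_left h1 (abs_nonneg (b * L + c))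
    have h8 : 0 < a * |t| := by positivity
    rw [add_sub_cancel_right]
    nlinarith
  set T := 4 * (|b| + |b * L + c|) / a + 1 + |m - L| with hT
  have hT1 : 4 * (|b| + |b * L + c|) / a + 1 ≤ T := by linarith [abs_nonneg (m - L)]
  have hT2 : |m - L| < T := by
    have : 0 ≤ 4 * (|b| + |b * L + c|) / a := by positivity
    linarith
  have hT0 : 0 < T := (abs_nonneg _).trans_lt hT2
  obtain ⟨hl, hr⟩ := abs_lt.1 hT2
  exact hconv.ncard_zeros_eq_two (by fun_prop) (p := -T + L) (m := m) (q := T + L)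
    (by linarith) (by linarith) (pos_of_large _ (by rwa [abs_neg, abs_of_pos hT0])) hm
    (pos_of_large _ (by rwa [abs_of_pos hT0]))

theorem half_log_eq_artanh_inv {A : ℝ} (hA : 1 < A) :
    1 / 2 * Real.log ((A + 1) / (A - 1)) = Real.artanh A⁻¹ := by
  have hA0 : 0 < A := by linarith
  have hA1 : A - 1 ≠ 0 := by linarith
  have hi : A⁻¹ < 1 := inv_lt_one_of_one_lt₀ hA
  have hi0 : 0 < A⁻¹ := inv_pos.2 hA0
  rw [Real.artanh_eq_half_log ⟨by linarith, hi.le⟩]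
  congr 2
  field_simp

theorem sqrt_one_sub_inv_sq {A : ℝ} (hA : 1 < A) :
    Real.sqrt (1 - A⁻¹ ^ 2) = Real.sqrt (A ^ 2 - 1) / A := by
  have hA0 : 0 < A := by linarith
  rw [show 1 - A⁻¹ ^ 2 = (A ^ 2 - 1) / A ^ 2 by field_simp, Real.sqrt_div' _ (sq_nonneg A),
    Real.sqrt_sq hA0.le]

theorem sqrt_mul_sinh_half_log {A : ℝ} (hA : 1 < A) :
    Real.sqrt (A ^ 2 - 1) * Real.sinh (1 / 2 * Real.log ((A + 1) / (A - 1))) = 1 := by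
  have hA0 : 0 < A := by linarith
  have hi : A⁻¹ < 1 := inv_lt_one_of_one_lt₀ hA
  have hi0 : 0 < A⁻¹ := inv_pos.2 hA0
  have hS : 0 < Real.sqrt (A ^ 2 - 1) := Real.sqrt_pos.2 (by nlinarith)
  rw [half_log_eq_artanh_inv hA, Real.sinh_artanh ⟨by linarith, hi⟩, sqrt_one_sub_inv_sq hA]
  field_simp

theorem sqrt_mul_cosh_half_log {A : ℝ} (hA : 1 < A) :
    Real.sqrt (A ^ 2 - 1) * Real.cosh (1 / 2 * Real.log ((A + 1) / (A - 1))) = A := by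
  have hA0 : 0 < A := by linarith
  have hi : A⁻¹ < 1 := inv_lt_one_of_one_lt₀ hA
  have hi0 : 0 < A⁻¹ := inv_pos.2 hA0
  have hS : 0 < Real.sqrt (A ^ 2 - 1) := Real.sqrt_pos.2 (by nlinarith)
  rw [half_log_eq_artanh_inv hA, Real.cosh_artanh ⟨by linarith, hi⟩, sqrt_one_sub_inv_sq hA]
  field_simp

theorem sin_eq_zero_iff_of_mem_Icc {x : ℝ} (hx : x ∈ Set.Icc (-Real.pi) Real.pi) :
    Real.sin x = 0 ↔ x = -Real.pi ∨ x = 0 ∨ x = Real.pi := by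
  refine ⟨fun h => ?_, ?_⟩
  · rcases hx.1.eq_or_lt with h1 | h1
    · exact Or.inl h1.symm
    rcases hx.2.eq_or_lt with h2 | h2
    · exact Or.inr (Or.inr h2)
    exact Or.inr (Or.inl ((Real.sin_eq_zero_iff_of_lt_of_lt h1 h2).1 h))
  · rintro (rfl | rfl | rfl) <;> simp

/-- for `A > 1`, `γ₁ > 0`, `𝔠 > 0`, under the conditions
`arsinh(1/R̃) − coth(arsinh(1/R̃)) > k𝔠/γ₁ + L̃` and `F(0,−ε₁) < 0`, the system
has exactly `6` singular points in `[−π,π] × ℝ`: `F(0,·)` and `F(±π,·)` have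
two zeros each, and no singular point lies on the line `Y = L̃` away from
`X ∈ {−π,0,π}`. -/
theorem stmt17 (A k 𝔠 γ₁ ε₁ M₁ L R : ℝ) (hA : 1 < A)
    (hk : 0 < k) (h𝔠 : 0 < 𝔠) (hγ : 0 < γ₁) (hε : 0 < ε₁) (hε1 : ε₁ < 1)
    (hM : M₁ = ε₁ * (k * 𝔠))
    (hL : L = (1 / 2) * Real.log ((A + 1) / (A - 1)))
    (hR : R = M₁ * Real.sqrt (A ^ 2 - 1) / γ₁)
    (hcond1 : Real.arsinh (1 / R) - coth (Real.arsinh (1 / R))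
        > k * 𝔠 / γ₁ + L)
    (hcond2 : Fup M₁ (k * 𝔠) γ₁ A 0 (-ε₁) < 0) :
    {p : ℝ × ℝ | p.1 ∈ Set.Icc (-Real.pi) Real.pi ∧
        Fup M₁ (k * 𝔠) γ₁ A p.1 p.2 = 0 ∧ Gup M₁ A p.1 p.2 = 0}.ncard = 6 ∧
    {Y : ℝ | Fup M₁ (k * 𝔠) γ₁ A 0 Y = 0}.ncard = 2 ∧
    (∀ Y : ℝ, Fup M₁ (k * 𝔠) γ₁ A Real.pi Y
        = Fup M₁ (k * 𝔠) γ₁ A (-Real.pi) Y) ∧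
    {Y : ℝ | Fup M₁ (k * 𝔠) γ₁ A Real.pi Y = 0}.ncard = 2 ∧
    (∀ X : ℝ, Real.sin X ≠ 0 → Fup M₁ (k * 𝔠) γ₁ A X L ≠ 0) := by
  have hν : 0 < k * 𝔠 := mul_pos hk h𝔠
  set ν := k * 𝔠
  have hM0 : 0 < M₁ := hM ▸ mul_pos hε hν
  have hS : 0 < Real.sqrt (A ^ 2 - 1) := Real.sqrt_pos.2 (by nlinarith)
  have hsinh := sqrt_mul_sinh_half_log hA
  have hcosh := sqrt_mul_cosh_half_log hA
  rw [← hL] at hsinh hcosh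
  set S := Real.sqrt (A ^ 2 - 1)
  have hL0 : 0 < L := by
    rw [← Real.sinh_pos_iff]
    by_contra! h
    nlinarith
  have hR0 : 0 < R := by rw [hR]; positivity
  have hRγ : M₁ * S = γ₁ * R := by rw [hR]; field_simp
  have hF : ∀ X Y, Fup M₁ ν γ₁ A X Y
      = γ₁ * R * Real.cos X * Real.cosh (Y - L) - ν - γ₁ * Y := by
    intro X Y
    rw [Fup, Real.cosh_sub, ← hRγ]
    linear_combination (-M₁ * Real.cos X * Real.cosh Y) * hcosh
      + (M₁ * Real.cos X * Real.sinh Y) * hsinh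
  have hG : ∀ X Y, Gup M₁ A X Y = M₁ * S * Real.sin X * Real.sinh (Y - L) := by
    intro X Y
    rw [Gup, Real.sinh_sub]
    linear_combination (-M₁ * Real.sin X * Real.sinh Y) * hcosh
      + (M₁ * Real.sin X * Real.cosh Y) * hsinh
  have hγR : 0 < γ₁ * R := mul_pos hγ hR0
  have hzero : {Y : ℝ | Fup M₁ ν γ₁ A 0 Y = 0}.ncard = 2 := by
    have heq : ∀ Y, Fup M₁ ν γ₁ A 0 Y
        = γ₁ * R * Real.cosh (Y - L) + (-γ₁) * Y + (-ν) := by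
      intro Y
      rw [hF, Real.cos_zero]
      ring
    rw [heq] at hcond2
    simp only [heq]
    exact ncard_zeros_cosh_add_linear hγR hcond2
  have hsymm : ∀ Y, Fup M₁ ν γ₁ A Real.pi Y = Fup M₁ ν γ₁ A (-Real.pi) Y := by
    intro Y
    simp only [Fup, Real.cos_neg]
  have hpi : {Y : ℝ | Fup M₁ ν γ₁ A Real.pi Y = 0}.ncard = 2 := by
    have heq : ∀ Y, Fup M₁ ν γ₁ A Real.pi Y = 0
        ↔ γ₁ * R * Real.cosh (Y - L) + γ₁ * Y + ν = 0 := by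
      intro Y
      rw [hF, Real.cos_pi, ← neg_eq_zero]
      ring_nf
    simp only [heq]
    refine ncard_zeros_cosh_add_linear (m := L - Real.arsinh (1 / R)) hγR ?_
    rw [coth, Real.sinh_arsinh, div_div_eq_mul_div, div_one] at hcond1
    rw [sub_sub_cancel_left, Real.cosh_neg]
    have h := mul_lt_mul_of_pos_left hcond1 hγ
    rw [mul_add, mul_div_cancel₀ _ hγ.ne'] at h
    linarith
  have hline : ∀ X : ℝ, Real.sin X ≠ 0 → Fup M₁ ν γ₁ A X L ≠ 0 := by
    intro X _ h
    rw [hF, sub_self, Real.cosh_zero, mul_one] at h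
    rw [hF, Real.cos_zero, mul_one] at hcond2
    have h1 := mul_le_mul_of_nonneg_left (Real.cos_le_one X) hγR.le
    have h2 := mul_le_mul_of_nonneg_left (Real.one_le_cosh (-ε₁ - L)) hγR.le
    have h3 := mul_pos hγ hL0
    have h4 := mul_pos hγ hε
    linarith
  refine ⟨?_, hzero, hsymm, hpi, hline⟩
  obtain ⟨u, v, huv, hZ⟩ := Set.ncard_eq_two.1 hzero
  obtain ⟨s, t, hst, hP⟩ := Set.ncard_eq_two.1 hpi
  have hset : {p : ℝ × ℝ | p.1 ∈ Set.Icc (-Real.pi) Real.pi ∧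
      Fup M₁ ν γ₁ A p.1 p.2 = 0 ∧ Gup M₁ A p.1 p.2 = 0}
      = (({(-Real.pi, s), (-Real.pi, t), (0, u), (0, v), (Real.pi, s), (Real.pi, t)} :
        Finset (ℝ × ℝ)) : Set (ℝ × ℝ)) := by
    have hZ' : ∀ Y, Fup M₁ ν γ₁ A 0 Y = 0 ↔ Y = u ∨ Y = v := fun Y => Set.ext_iff.1 hZ Y
    have hP' : ∀ Y, Fup M₁ ν γ₁ A Real.pi Y = 0 ↔ Y = s ∨ Y = t := fun Y => Set.ext_iff.1 hP Y
    have hN' : ∀ Y, Fup M₁ ν γ₁ A (-Real.pi) Y = 0 ↔ Y = s ∨ Y = t := fun Y => by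
      rw [← hsymm, hP']
    ext ⟨X, Y⟩
    have hX : (X ∈ Set.Icc (-Real.pi) Real.pi ∧ Fup M₁ ν γ₁ A X Y = 0 ∧ Gup M₁ A X Y = 0)
        ↔ (X = -Real.pi ∨ X = 0 ∨ X = Real.pi) ∧ Fup M₁ ν γ₁ A X Y = 0 := by
      constructor
      · rintro ⟨hX, hf, hg⟩
        refine ⟨(sin_eq_zero_iff_of_mem_Icc hX).1 ?_, hf⟩
        by_contra hs
        rw [hG, mul_eq_zero, or_iff_right (mul_ne_zero (by positivity) hs), Real.sinh_eq_zero,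
          sub_eq_zero] at hg
        exact hline X hs (hg ▸ hf)
      · rintro ⟨hX, hf⟩
        have hmem : X ∈ Set.Icc (-Real.pi) Real.pi := by
          have := Real.pi_pos
          rcases hX with rfl | rfl | rfl <;> constructor <;> linarith
        refine ⟨hmem, hf, ?_⟩
        rw [hG, (sin_eq_zero_iff_of_mem_Icc hmem).2 hX]
        ring
    simp only [Set.mem_ofPred_eq, hX, Finset.coe_insert, Finset.coe_singleton,
      Set.mem_insert_iff, Set.mem_singleton_iff, Prod.mk.injEq]
    constructor
    · rintro ⟨rfl | rfl | rfl, hf⟩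
      · rcases (hN' Y).1 hf with h | h <;> simp [h]
      · rcases (hZ' Y).1 hf with h | h <;> simp [h]
      · rcases (hP' Y).1 hf with h | h <;> simp [h]
    · rintro (⟨rfl, rfl⟩ | ⟨rfl, rfl⟩ | ⟨rfl, rfl⟩ | ⟨rfl, rfl⟩ | ⟨rfl, rfl⟩ | ⟨rfl, rfl⟩) <;>
        simp [hN', hZ', hP']
  rw [hset, Set.ncard_coe_finset]
  have hπ := Real.pi_pos
  have h1 : -Real.pi ≠ 0 := by linarith
  have h2 : -Real.pi ≠ Real.pi := by linarith
  rw [Finset.card_insert_of_notMem, Finset.card_insert_of_notMem, Finset.card_insert_of_notMem,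
    Finset.card_insert_of_notMem, Finset.card_insert_of_notMem, Finset.card_singleton] <;>
    simp [huv, hst, h2, Real.pi_ne_zero, Real.pi_ne_zero.symm]
end

section
/- Let A > 1, k > 0, 𝔠 < 0, γ₁ > 0 (the critical-layer regime), ε₁ ∈ (0,1), set M₁ := ε₁·k𝔠 < 0, L̃ := (1/2)·log((A+1)/(A−1)), and Y⁺₀ := L̃ + arsinh(γ₁/(M₁·√(A²−1))) (the unique critical point of Y ↦ F(0,Y)). Assume F(π, L̃) < 0 and F(0, Y⁺₀) > 0. Then the set of singular points {(X,Y) ∈ [−π,π]×ℝ : F(X,Y) = 0 and G(X,Y) = 0} has exactly 6 elements; more precisely, the function Y ↦ F(0,Y) has exactly two real zeros, the function Y ↦ F(π,Y) = F(−π,Y) has exactly two real zeros, and F(X, L̃) ≠ 0 for every X ∈ [−π,π], so no singular points occur on the line Y = L̃. -/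
/-- A convex continuous function that is negative somewhere and nonnegative somewhere on each side
has exactly two zeros. -/
theorem ncard_zeros_of_convexOn {f : ℝ → ℝ} (hf : ConvexOn ℝ Set.univ f) (hc : Continuous f)
    {l m r : ℝ} (hlm : l < m) (hmr : m < r) (hl : 0 ≤ f l) (hm : f m < 0) (hr : 0 ≤ f r) :
    {y : ℝ | f y = 0}.ncard = 2 := by
  have key : ∀ {x y z : ℝ}, x < y → y < z → (z - x) * f y ≤ (z - y) * f x + (y - x) * f z := by
    intro x y z hxy hyz
    have h := hf.slope_mono_adjacent (Set.mem_univ x) (Set.mem_univ z) hxy hyz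
    rw [div_le_div_iff₀ (sub_pos.2 hxy) (sub_pos.2 hyz)] at h
    linarith
  obtain ⟨u, ⟨-, hum⟩, hu⟩ := intermediate_value_Icc' hlm.le hc.continuousOn ⟨hm.le, hl⟩
  obtain ⟨v, ⟨hmv, -⟩, hv⟩ := intermediate_value_Icc hmr.le hc.continuousOn ⟨hm.le, hr⟩
  have ne_m : ∀ {w : ℝ}, f w = 0 → w ≠ m := by
    rintro w hw rfl
    exact hm.ne hw
  have hum' := lt_of_le_of_ne hum (ne_m hu)
  have hmv' := lt_of_le_of_ne hmv (ne_m hv).symm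
  have right : ∀ {x y : ℝ}, m < x → x < y → f x = 0 → f y = 0 → False := by
    intro x y hx hxy h1 h2
    have h := key hx hxy
    rw [h1, h2] at h
    nlinarith [mul_pos (sub_pos.2 hxy) (neg_pos.2 hm)]
  have left : ∀ {x y : ℝ}, x < y → y < m → f x = 0 → f y = 0 → False := by
    intro x y hxy hy h1 h2
    have h := key hxy hy
    rw [h1, h2] at h
    nlinarith [mul_pos (sub_pos.2 hxy) (neg_pos.2 hm)]
  refine Set.ncard_eq_two.2 ⟨u, v, (hum'.trans hmv').ne, ?_⟩
  ext w
  simp only [Set.mem_ofPred_eq, Set.mem_insert_iff, Set.mem_singleton_iff]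
  refine ⟨fun hw => ?_, by rintro (rfl | rfl) <;> assumption⟩
  rcases lt_or_gt_of_ne (ne_m hw) with h | h
  · left
    rcases lt_trichotomy w u with h' | h' | h'
    · exact (left h' hum' hw hu).elim
    · exact h'
    · exact (left h' h hu hw).elim
  · right
    rcases lt_trichotomy w v with h' | h' | h'
    · exact (right h h' hw hv).elim
    · exact h'
    · exact (right hmv' h' hv hw).elim

theorem convexOn_cosh : ConvexOn ℝ Set.univ Real.cosh := by
  have h : ConvexOn ℝ Set.univ fun x : ℝ => Real.exp (-x) :=
    convexOn_exp.comp_linearMap (-LinearMap.id)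
  refine ((convexOn_exp.add h).smul (by norm_num : (0 : ℝ) ≤ 1 / 2)).congr fun x _ => ?_
  simp only [Pi.add_apply, smul_eq_mul, Real.cosh_eq]
  ring

theorem sq_div_four_le_cosh (x : ℝ) : x ^ 2 / 4 ≤ Real.cosh x := by
  rw [← Real.cosh_abs, ← sq_abs, Real.cosh_eq]
  linarith [Real.quadratic_le_exp_of_nonneg (abs_nonneg x), Real.exp_pos (-|x|), abs_nonneg x]

theorem ncard_zeros_cosh_sub_linear {a b c d m : ℝ} (ha : 0 < a)
    (hm : a * Real.cosh (m - d) - b - c * m < 0) :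
    {y : ℝ | a * Real.cosh (y - d) - b - c * y = 0}.ncard = 2 := by
  have hconv : ConvexOn ℝ Set.univ fun y : ℝ => a * Real.cosh (y - d) - b - c * y := by
    have h1 : ConvexOn ℝ Set.univ fun y : ℝ => Real.cosh (y - d) := by
      simpa [sub_eq_add_neg, Function.comp_def] using convexOn_cosh.translate_left (-d)
    have h2 : ConvexOn ℝ Set.univ fun y : ℝ => -b - c * y := by
      refine ⟨convex_univ, fun x _ y _ s t _ _ hst => le_of_eq ?_⟩
      simp only [smul_eq_mul]
      linear_combination b * hst
    refine ((h1.smul ha.le).add h2).congr fun x _ => ?_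
    simp only [Pi.add_apply, smul_eq_mul]
    ring
  have hcont : Continuous fun y : ℝ => a * Real.cosh (y - d) - b - c * y := by fun_prop
  set B := |b + c * d| + |c| with hB
  have hB0 : 0 ≤ B := by positivity
  set R := 1 + |m - d| + 4 * B / a with hR
  have hBa : 0 ≤ 4 * B / a := by positivity
  have hR1 : 1 ≤ R := by linarith [abs_nonneg (m - d)]
  have haR : 4 * B ≤ a * R := by
    have : a * (4 * B / a) = 4 * B := by field_simp
    nlinarith [mul_nonneg ha.le (abs_nonneg (m - d))]
  have large : ∀ t : ℝ, |t| = R → 0 ≤ a * Real.cosh (d + t - d) - b - c * (d + t) := by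
    intro t ht
    rw [add_sub_cancel_left]
    have h1 := mul_le_mul_of_nonneg_left (sq_div_four_le_cosh t) ha.le
    rw [← sq_abs t, ht] at h1
    have h2 : c * t ≤ |c| * R := by rw [← ht, ← abs_mul]; exact le_abs_self _
    have h3 := le_abs_self (b + c * d)
    have h4 : 4 * B * R ≤ a * R * R := mul_le_mul_of_nonneg_right haR (by linarith)
    nlinarith [mul_nonneg (abs_nonneg (b + c * d)) (sub_nonneg.2 hR1)]
  have hR0 : 0 ≤ R := by linarith
  exact ncard_zeros_of_convexOn hconv hcont (l := d + -R) (r := d + R)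
    (by linarith [neg_abs_le (m - d)]) (by linarith [le_abs_self (m - d)])
    (large _ (by rw [abs_neg, abs_of_nonneg hR0])) hm (large _ (abs_of_nonneg hR0))

theorem exp_half_log_ratio_mul {A : ℝ} (hA : 1 < A) :
    Real.exp ((1 / 2) * Real.log ((A + 1) / (A - 1))) * (A - 1) = Real.sqrt (A ^ 2 - 1) ∧
    Real.exp (-((1 / 2) * Real.log ((A + 1) / (A - 1)))) * (A + 1) = Real.sqrt (A ^ 2 - 1) := by
  have h1 : 0 < A - 1 := by linarith
  have h2 : 0 < A + 1 := by linarith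
  have hs : Real.exp ((1 / 2) * Real.log ((A + 1) / (A - 1))) ^ 2 = (A + 1) / (A - 1) := by
    rw [← Real.exp_nat_mul, ← Real.exp_log (div_pos h2 h1)]
    simp
  have hfst : Real.exp ((1 / 2) * Real.log ((A + 1) / (A - 1))) * (A - 1)
      = Real.sqrt (A ^ 2 - 1) := by
    symm
    rw [Real.sqrt_eq_iff_mul_self_eq (by nlinarith) (by positivity), ← sq, mul_pow, hs]
    field_simp
    ring
  refine ⟨hfst, ?_⟩
  rw [← hfst, Real.exp_neg, inv_mul_eq_div, div_eq_iff (Real.exp_pos _).ne']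
  rw [eq_div_iff h1.ne'] at hs
  linear_combination -hs

theorem mul_cosh_sub_sinh {A : ℝ} (hA : 1 < A) (Y : ℝ) :
    A * Real.cosh Y - Real.sinh Y = Real.sqrt (A ^ 2 - 1) *
      Real.cosh (Y - (1 / 2) * Real.log ((A + 1) / (A - 1))) := by
  obtain ⟨h1, h2⟩ := exp_half_log_ratio_mul hA
  set L := (1 / 2) * Real.log ((A + 1) / (A - 1))
  have h3 : Real.exp L * Real.exp (-L) = 1 := by rw [← Real.exp_add]; simp
  rw [Real.cosh_eq Y, Real.sinh_eq, Real.cosh_eq (Y - L), neg_sub, sub_eq_add_neg Y,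
    sub_eq_add_neg L, Real.exp_add, Real.exp_add]
  linear_combination Real.exp Y / 2 * (Real.exp (-L) * h1 - (A - 1) * h3) +
    Real.exp (-Y) / 2 * (Real.exp L * h2 - (A + 1) * h3)

theorem mul_sinh_sub_cosh {A : ℝ} (hA : 1 < A) (Y : ℝ) :
    A * Real.sinh Y - Real.cosh Y = Real.sqrt (A ^ 2 - 1) *
      Real.sinh (Y - (1 / 2) * Real.log ((A + 1) / (A - 1))) := by
  obtain ⟨h1, h2⟩ := exp_half_log_ratio_mul hA
  set L := (1 / 2) * Real.log ((A + 1) / (A - 1))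
  have h3 : Real.exp L * Real.exp (-L) = 1 := by rw [← Real.exp_add]; simp
  rw [Real.sinh_eq Y, Real.cosh_eq, Real.sinh_eq (Y - L), neg_sub, sub_eq_add_neg Y,
    sub_eq_add_neg L, Real.exp_add, Real.exp_add]
  linear_combination Real.exp Y / 2 * (Real.exp (-L) * h1 - (A - 1) * h3) -
    Real.exp (-Y) / 2 * (Real.exp L * h2 - (A + 1) * h3)

/-- the critical-layer regime `A > 1`, `γ₁ > 0`, `𝔠 < 0`, with
`Y⁺₀ = L̃ + arsinh(γ₁/(M₁√(A²−1)))` the unique critical point of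
`Y ↦ F(0,Y)`; under the conditions `F(π,L̃) < 0` and `F(0,Y⁺₀) > 0`, the
system has exactly `6` singular points in `[−π,π] × ℝ`: `F(0,·)` and
`F(±π,·)` have two zeros each, and no singular point lies on the line
`Y = L̃`. -/
theorem stmt19 (A k 𝔠 γ₁ ε₁ M₁ L Yp0 : ℝ) (hA : 1 < A)
    (hk : 0 < k) (h𝔠 : 𝔠 < 0) (hγ : 0 < γ₁)
    (hε : 0 < ε₁) (hε1 : ε₁ < 1) (hM : M₁ = ε₁ * (k * 𝔠))
    (hL : L = (1 / 2) * Real.log ((A + 1) / (A - 1)))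
    (hYp0 : Yp0 = L + Real.arsinh (γ₁ / (M₁ * Real.sqrt (A ^ 2 - 1))))
    (hcond1 : Fup M₁ (k * 𝔠) γ₁ A Real.pi L < 0)
    (hcond2 : 0 < Fup M₁ (k * 𝔠) γ₁ A 0 Yp0) :
    {p : ℝ × ℝ | p.1 ∈ Set.Icc (-Real.pi) Real.pi ∧
        Fup M₁ (k * 𝔠) γ₁ A p.1 p.2 = 0 ∧ Gup M₁ A p.1 p.2 = 0}.ncard = 6 ∧
    {Y : ℝ | Fup M₁ (k * 𝔠) γ₁ A 0 Y = 0}.ncard = 2 ∧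
    (∀ Y : ℝ, Fup M₁ (k * 𝔠) γ₁ A Real.pi Y
        = Fup M₁ (k * 𝔠) γ₁ A (-Real.pi) Y) ∧
    {Y : ℝ | Fup M₁ (k * 𝔠) γ₁ A Real.pi Y = 0}.ncard = 2 ∧
    (∀ X : ℝ, X ∈ Set.Icc (-Real.pi) Real.pi →
        Fup M₁ (k * 𝔠) γ₁ A X L ≠ 0) := by
  subst hL
  set L := (1 / 2) * Real.log ((A + 1) / (A - 1))
  set S := Real.sqrt (A ^ 2 - 1)
  set ν := k * 𝔠
  have hS : 0 < S := Real.sqrt_pos.2 (by nlinarith)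
  have hM0 : M₁ < 0 := by
    rw [hM]
    exact mul_neg_of_pos_of_neg hε (mul_neg_of_pos_of_neg hk h𝔠)
  have hMS : 0 < -(M₁ * S) := neg_pos.2 (mul_neg_of_neg_of_pos hM0 hS)
  have hF : ∀ X Y, Fup M₁ ν γ₁ A X Y
      = M₁ * S * Real.cos X * Real.cosh (Y - L) - ν - γ₁ * Y := by
    intro X Y
    rw [Fup, mul_cosh_sub_sinh hA]
    ring
  have hG : ∀ X Y, Gup M₁ A X Y = M₁ * S * (Real.sin X * Real.sinh (Y - L)) := by
    intro X Y
    rw [Gup, mul_sinh_sub_cosh hA]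
    ring
  have hFneg : ∀ Y, Fup M₁ ν γ₁ A Real.pi Y = Fup M₁ ν γ₁ A (-Real.pi) Y := by
    intro Y
    simp only [Fup, Real.cos_neg]
  have hzero : {Y : ℝ | Fup M₁ ν γ₁ A 0 Y = 0}.ncard = 2 := by
    have h : -(M₁ * S) * Real.cosh (Yp0 - L) - -ν - -γ₁ * Yp0 < 0 := by
      rw [hF, Real.cos_zero] at hcond2
      linarith
    rw [← ncard_zeros_cosh_sub_linear hMS h]
    congr 1
    ext Y
    simp only [Set.mem_ofPred_eq, hF, Real.cos_zero]
    constructor <;> intro h <;> linarith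
  have hpi : {Y : ℝ | Fup M₁ ν γ₁ A Real.pi Y = 0}.ncard = 2 := by
    have h : -(M₁ * S) * Real.cosh (L - L) - ν - γ₁ * L < 0 := by
      rw [hF, Real.cos_pi] at hcond1
      linarith
    rw [← ncard_zeros_cosh_sub_linear hMS h]
    congr 1
    ext Y
    simp only [Set.mem_ofPred_eq, hF, Real.cos_pi]
    constructor <;> intro h <;> linarith
  have hline : ∀ X : ℝ, Fup M₁ ν γ₁ A X L ≠ 0 := by
    intro X
    rw [hF, Real.cos_pi] at hcond1
    rw [hF]
    simp only [sub_self, Real.cosh_zero, mul_one] at hcond1 ⊢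
    nlinarith [mul_nonneg hMS.le (by linarith [Real.neg_one_le_cos X] : 0 ≤ Real.cos X + 1)]
  refine ⟨?_, hzero, hFneg, hpi, fun X _ => hline X⟩
  have hset : {p : ℝ × ℝ | p.1 ∈ Set.Icc (-Real.pi) Real.pi ∧
      Fup M₁ ν γ₁ A p.1 p.2 = 0 ∧ Gup M₁ A p.1 p.2 = 0} =
      ({0} ×ˢ {Y : ℝ | Fup M₁ ν γ₁ A 0 Y = 0}) ∪
        ({-Real.pi, Real.pi} ×ˢ {Y : ℝ | Fup M₁ ν γ₁ A Real.pi Y = 0}) := by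
    ext ⟨X, Y⟩
    simp only [Set.mem_ofPred_eq, Set.mem_union, Set.mem_prod, Set.mem_singleton_iff,
      Set.mem_insert_iff, Set.mem_Icc]
    constructor
    · rintro ⟨⟨h1, h2⟩, hFXY, hGXY⟩
      rw [hG] at hGXY
      rcases mul_eq_zero.1 ((mul_eq_zero.1 hGXY).resolve_left (neg_pos.1 hMS).ne) with h | h
      · rcases h1.eq_or_lt with rfl | h1
        · exact Or.inr ⟨Or.inl rfl, by rwa [hFneg]⟩
        rcases h2.eq_or_lt with rfl | h2
        · exact Or.inr ⟨Or.inr rfl, hFXY⟩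
        obtain rfl := (Real.sin_eq_zero_iff_of_lt_of_lt h1 h2).1 h
        exact Or.inl ⟨rfl, hFXY⟩
      · obtain rfl := sub_eq_zero.1 (Real.sinh_eq_zero.1 h)
        exact (hline X hFXY).elim
    · have hπ := Real.pi_pos
      rintro (⟨rfl, h⟩ | ⟨rfl | rfl, h⟩)
      · exact ⟨⟨by linarith, by linarith⟩, h, by simp [Gup]⟩
      · exact ⟨⟨by linarith, by linarith⟩, by rwa [← hFneg], by simp [Gup]⟩
      · exact ⟨⟨by linarith, by linarith⟩, h, by simp [Gup]⟩
  have hfin₁ : ({0} ×ˢ {Y : ℝ | Fup M₁ ν γ₁ A 0 Y = 0} : Set (ℝ × ℝ)).Finite :=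
    (Set.finite_singleton _).prod (Set.finite_of_ncard_ne_zero (by rw [hzero]; norm_num))
  have hfin₂ : ({-Real.pi, Real.pi} ×ˢ {Y : ℝ | Fup M₁ ν γ₁ A Real.pi Y = 0} :
      Set (ℝ × ℝ)).Finite :=
    (Set.toFinite _).prod (Set.finite_of_ncard_ne_zero (by rw [hpi]; norm_num))
  have hπ := Real.pi_pos
  rw [hset, Set.ncard_union_eq ?_ hfin₁ hfin₂, Set.ncard_prod, Set.ncard_prod, hzero, hpi,
    Set.ncard_singleton, Set.ncard_pair (by linarith)]
  refine Set.disjoint_left.2 ?_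
  rintro ⟨X, Y⟩ ⟨h1, -⟩ ⟨h2, -⟩
  simp only [Set.mem_singleton_iff, Set.mem_insert_iff] at h1 h2
  rcases h2 with h2 | h2 <;> linarith
end
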